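/- (Clone consistency) Let v be a complete Llull matrix on a finite set A and let C ⊊ A be an autonomous set for v. Then C is autonomous for the indirect comparison relation ν = {(x,y) : v*_{xy} > v*_{yx}}, and C is autonomous for the total preorder determined by the rank-like rates, i.e. for the relation {(x,y) : x ≠ y, R_x ≤ R_y}. -/

import Mathlib

/-! Common definitions: valued relations, indirect scores, admissible orders,
projected margins/scores, rank-like rates (Camps–Mora–Saumell CLC method). -/

variable {A : Type*} [Fintype A] [DecidableEq A]

/-- The score of a chain `x₀ :: x₁ :: ... :: xₙ`: the minimum of `v xᵢ xᵢ₊₁`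
over its links (value `1` for chains with no link, which we never use). -/
noncomputable def linkScore (v : A → A → ℝ) : List A → ℝ
  | [] => 1
  | [_] => 1
  | [a, b] => v a b
  | a :: b :: c :: l => min (v a b) (linkScore v (b :: c :: l))

/-- The indirect score `v*_{xy}`: the supremum (= maximum) of the scores of all
paths from `x` to `y` (with at least one link, consecutive elements distinct). -/
noncomputable def istar (v : A → A → ℝ) (x y : A) : ℝ :=
  sSup { s : ℝ | ∃ l : List A, List.Chain' (· ≠ ·) (x :: (l ++ [y])) ∧
      s = linkScore v (x :: (l ++ [y])) }

/-- `ξ` is a strict total order: irreflexive, transitive, total. -/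
def StrictTotal (ξ : A → A → Prop) : Prop :=
  (∀ x, ¬ ξ x x) ∧ (∀ x y z, ξ x y → ξ y z → ξ x z) ∧ (∀ x y, x ≠ y → ξ x y ∨ ξ y x)

/-- `ξ` is admissible for `v`: `v*_{xy} > v*_{yx}` implies `x` precedes `y`. -/
def Adm (v : A → A → ℝ) (ξ : A → A → Prop) : Prop :=
  ∀ x y, istar v x y > istar v y x → ξ x y

/-- Intermediate projected margin `m^σ_{xy}` (for `x` preceding `y` in `ξ`):
the infimum (= minimum) of the indirect margins `m*_{pq}` over `p ⪯ x`, `y ⪯ q`. -/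
noncomputable def msigma (v : A → A → ℝ) (ξ : A → A → Prop) (x y : A) : ℝ :=
  sInf { s : ℝ | ∃ p q, (ξ p x ∨ p = x) ∧ (ξ y q ∨ q = y) ∧
      s = istar v p q - istar v q p }

/-- `q` is the immediate successor of `p` in `ξ`. -/
def ImmSucc (ξ : A → A → Prop) (p q : A) : Prop :=
  ξ p q ∧ ∀ z, ¬ (ξ p z ∧ ξ z q)

/-- Projected margin (for `x` preceding `y` in `ξ`): the supremum (= maximum) of
`m^σ_{p p'}` over `x ⪯ p ≺ y`, `p'` the immediate successor of `p`. -/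
noncomputable def mpiAux (v : A → A → ℝ) (ξ : A → A → Prop) (x y : A) : ℝ :=
  sSup { s : ℝ | ∃ p q, (ξ x p ∨ p = x) ∧ ξ p y ∧ ImmSucc ξ p q ∧
      s = msigma v ξ p q }

open Classical in
/-- Projected margins `m^π`, extended antisymmetrically. -/
noncomputable def mpi (v : A → A → ℝ) (ξ : A → A → Prop) (x y : A) : ℝ :=
  if ξ x y then mpiAux v ξ x y else - mpiAux v ξ y x

/-- Projected scores `v^π_{xy} = (1 + m^π_{xy})/2`. -/
noncomputable def vpi (v : A → A → ℝ) (ξ : A → A → Prop) (x y : A) : ℝ :=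
  (1 + mpi v ξ x y) / 2

/-- Rank-like rate `R_x = N - ∑_{y ≠ x} v^π_{xy}`. -/
noncomputable def rlr (v : A → A → ℝ) (ξ : A → A → Prop) (x : A) : ℝ :=
  (Fintype.card A : ℝ) - ∑ y ∈ Finset.univ.erase x, vpi v ξ x y

/-- `v` is a complete Llull matrix: scores of distinct pairs lie in `[0,1]`
and satisfy `v_{xy} + v_{yx} = 1`. -/
def Llull (v : A → A → ℝ) : Prop :=
  ∀ x y : A, x ≠ y → 0 ≤ v x y ∧ v x y ≤ 1 ∧ v x y + v y x = 1

/-- `C` is autonomous for a relation `ρ`: every element outside `C` relates to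
all elements of `C` in the same way. -/
def AutonomousRel {A : Type*} (C : Set A) (ρ : A → A → Prop) : Prop :=
  ∀ x ∉ C, ((∃ a ∈ C, ρ a x) → ∀ b ∈ C, ρ b x) ∧
    ((∃ a ∈ C, ρ x a) → ∀ b ∈ C, ρ x b)

theorem linkScore_cons_cons {A : Type*} (v : A → A → ℝ) (a b : A) {l : List A} (hl : l ≠ []) :
    linkScore v (a :: b :: l) = min (v a b) (linkScore v (b :: l)) := by
  cases l with
  | nil => exact absurd rfl hl
  | cons c l => rfl

theorem linkScore_le_one {A : Type*} {v : A → A → ℝ} (hv : Llull v) :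
    ∀ l : List A, List.IsChain (· ≠ ·) l → linkScore v l ≤ 1
  | [], _ => le_rfl
  | [_], _ => le_rfl
  | [a, b], h => (hv a b (by simpa using h)).2.1
  | a :: b :: c :: l, h =>
    (min_le_left _ _).trans (hv a b (List.isChain_cons_cons.1 h).1).2.1

theorem linkScore_le_istar {A : Type*} {v : A → A → ℝ} (hv : Llull v) {x y : A} {l : List A}
    (hl : List.IsChain (· ≠ ·) (x :: (l ++ [y]))) :
    linkScore v (x :: (l ++ [y])) ≤ istar v x y := by
  refine le_csSup ⟨1, ?_⟩ ⟨l, hl, rfl⟩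
  rintro s ⟨l', hl', rfl⟩
  exact linkScore_le_one hv _ hl'

theorem istar_le_istar_of_paths {A : Type*} {v : A → A → ℝ} (hv : Llull v) {x y x' y' : A}
    (hxy : x ≠ y)
    (h : ∀ l : List A, List.IsChain (· ≠ ·) (x :: (l ++ [y])) →
      ∃ l' : List A, List.IsChain (· ≠ ·) (x' :: (l' ++ [y'])) ∧
        linkScore v (x :: (l ++ [y])) ≤ linkScore v (x' :: (l' ++ [y']))) :
    istar v x y ≤ istar v x' y' := by
  refine csSup_le ⟨_, [], List.isChain_pair.2 hxy, rfl⟩ ?_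
  rintro s ⟨l, hl, rfl⟩
  obtain ⟨l', hl', hle⟩ := h l hl
  exact hle.trans (linkScore_le_istar hv hl')

/-- A path that starts in an autonomous set and ends outside it can be made to start at any
other element of the set without lowering its score. -/
theorem exists_path_of_source_mem {A : Type*} {v : A → A → ℝ} {C : Set A}
    (haut : ∀ a ∈ C, ∀ b ∈ C, ∀ x ∉ C, v a x = v b x ∧ v x a = v x b)
    {b x : A} (hb : b ∈ C) (hx : x ∉ C) (l : List A) :
    ∀ a ∈ C, List.IsChain (· ≠ ·) (a :: (l ++ [x])) →
      ∃ l' : List A, List.IsChain (· ≠ ·) (b :: (l' ++ [x])) ∧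
        linkScore v (a :: (l ++ [x])) ≤ linkScore v (b :: (l' ++ [x])) := by
  induction l with
  | nil =>
    intro a ha _
    refine ⟨[], ?_, (haut a ha b hb x hx).1.le⟩
    have : b ≠ x := fun h => hx (h ▸ hb)
    simpa using this
  | cons c l ih =>
    intro a ha hl
    rw [List.cons_append, List.isChain_cons_cons] at hl
    rw [List.cons_append, linkScore_cons_cons v a c (by simp)]
    by_cases hc : c ∈ C
    · obtain ⟨l', hl', hle⟩ := ih c hc hl.2
      exact ⟨l', hl', (min_le_right _ _).trans hle⟩
    · refine ⟨c :: l, ?_, ?_⟩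
      · rw [List.cons_append, List.isChain_cons_cons]
        exact ⟨fun h => hc (h ▸ hb), hl.2⟩
      · rw [List.cons_append, linkScore_cons_cons v b c (by simp), (haut a ha b hb c hc).1]

/-- A path that starts outside an autonomous set and ends in it can be made to end at any
other element of the set without lowering its score. -/
theorem exists_path_of_target_mem {A : Type*} {v : A → A → ℝ} {C : Set A}
    (haut : ∀ a ∈ C, ∀ b ∈ C, ∀ x ∉ C, v a x = v b x ∧ v x a = v x b)
    {a b : A} (ha : a ∈ C) (hb : b ∈ C) (l : List A) :
    ∀ x ∉ C, List.IsChain (· ≠ ·) (x :: (l ++ [a])) →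
      ∃ l' : List A, List.IsChain (· ≠ ·) (x :: (l' ++ [b])) ∧
        linkScore v (x :: (l ++ [a])) ≤ linkScore v (x :: (l' ++ [b])) := by
  induction l with
  | nil =>
    intro x hx _
    refine ⟨[], ?_, (haut a ha b hb x hx).2.le⟩
    have : x ≠ b := fun h => hx (h ▸ hb)
    simpa using this
  | cons c l ih =>
    intro x hx hl
    rw [List.cons_append, List.isChain_cons_cons] at hl
    rw [List.cons_append, linkScore_cons_cons v x c (by simp)]
    by_cases hc : c ∈ C
    · refine ⟨[], ?_, (min_le_left _ _).trans (haut c hc b hb x hx).2.le⟩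
      have : x ≠ b := fun h => hx (h ▸ hb)
      simpa using this
    · obtain ⟨l', hl', hle⟩ := ih c hc hl.2
      refine ⟨c :: l', ?_, ?_⟩
      · rw [List.cons_append, List.isChain_cons_cons]
        exact ⟨hl.1, hl'⟩
      · rw [List.cons_append, linkScore_cons_cons v x c (by simp)]
        exact min_le_min_left _ hle

/-- An autonomous set for `v` is autonomous for the indirect scores. -/
theorem istar_autonomous {A : Type*} {v : A → A → ℝ} (hv : Llull v) {C : Set A}
    (haut : ∀ a ∈ C, ∀ b ∈ C, ∀ x ∉ C, v a x = v b x ∧ v x a = v x b)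
    {a b x : A} (ha : a ∈ C) (hb : b ∈ C) (hx : x ∉ C) :
    istar v a x = istar v b x ∧ istar v x a = istar v x b := by
  have hne : ∀ c ∈ C, c ≠ x := fun c hc h => hx (h ▸ hc)
  refine ⟨le_antisymm ?_ ?_, le_antisymm ?_ ?_⟩
  · exact istar_le_istar_of_paths hv (hne a ha)
      fun l => exists_path_of_source_mem haut hb hx l a ha
  · exact istar_le_istar_of_paths hv (hne b hb)
      fun l => exists_path_of_source_mem haut ha hx l b hb
  · exact istar_le_istar_of_paths hv (hne a ha).symm
      fun l => exists_path_of_target_mem haut ha hb l x hx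
  · exact istar_le_istar_of_paths hv (hne b hb).symm
      fun l => exists_path_of_target_mem haut hb ha l x hx

section Projection

variable {A : Type*} {v : A → A → ℝ} {ξ : A → A → Prop}

theorem StrictTotal.asymm (hξ : StrictTotal ξ) {x y : A} (h : ξ x y) : ¬ ξ y x :=
  fun h' => hξ.1 x (hξ.2.1 x y x h h')

theorem msigma_nonneg (hξ : StrictTotal ξ) (hadm : Adm v ξ) {x y : A} (hxy : ξ x y) :
    0 ≤ msigma v ξ x y := by
  refine Real.sInf_nonneg ?_
  rintro s ⟨p, q, hp, hq, rfl⟩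
  have hpq : ξ p q := by
    have h1 : ξ p y := by
      rcases hp with hp | rfl
      · exact hξ.2.1 _ _ _ hp hxy
      · exact hxy
    rcases hq with hq | rfl
    · exact hξ.2.1 _ _ _ h1 hq
    · exact h1
  by_contra! h
  exact hξ.asymm hpq (hadm q p (by linarith))

theorem finite_msigma_set [Finite A] (v : A → A → ℝ) (ξ : A → A → Prop) (x y : A) :
    { s : ℝ | ∃ p q, (ξ p x ∨ p = x) ∧ (ξ y q ∨ q = y) ∧
      s = istar v p q - istar v q p }.Finite := by
  refine (Set.finite_range fun pq : A × A => istar v pq.1 pq.2 - istar v pq.2 pq.1).subset ?_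
  rintro s ⟨p, q, -, -, rfl⟩
  exact ⟨(p, q), rfl⟩

theorem msigma_pos_iff [Finite A] {x y : A} :
    0 < msigma v ξ x y ↔
      ∀ p q, (ξ p x ∨ p = x) → (ξ y q ∨ q = y) → istar v p q > istar v q p := by
  constructor
  · intro h p q hp hq
    have : msigma v ξ x y ≤ istar v p q - istar v q p :=
      csInf_le (finite_msigma_set v ξ x y).bddBelow ⟨p, q, hp, hq, rfl⟩
    linarith
  · intro h
    obtain ⟨p, q, hp, hq, hs⟩ : msigma v ξ x y ∈ { s : ℝ | ∃ p q, (ξ p x ∨ p = x) ∧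
        (ξ y q ∨ q = y) ∧ s = istar v p q - istar v q p } :=
      Set.Nonempty.csInf_mem ⟨_, x, y, Or.inr rfl, Or.inr rfl, rfl⟩ (finite_msigma_set v ξ x y)
    rw [hs]
    exact sub_pos.2 (h p q hp hq)

theorem mpiAux_nonneg (hξ : StrictTotal ξ) (hadm : Adm v ξ) (x y : A) :
    0 ≤ mpiAux v ξ x y := by
  refine Real.sSup_nonneg ?_
  rintro s ⟨p, q, -, -, hpq, rfl⟩
  exact msigma_nonneg hξ hadm hpq.1

theorem msigma_le_mpiAux [Finite A] {x y p q : A} (hp : ξ x p ∨ p = x) (hpy : ξ p y)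
    (hpq : ImmSucc ξ p q) : msigma v ξ p q ≤ mpiAux v ξ x y := by
  refine le_csSup (Set.Finite.bddAbove ?_) ⟨p, q, hp, hpy, hpq, rfl⟩
  refine (Set.finite_range fun pq : A × A => msigma v ξ pq.1 pq.2).subset ?_
  rintro s ⟨p, q, -, -, -, rfl⟩
  exact ⟨(p, q), rfl⟩

theorem mpiAux_eq_max [Finite A] (hξ : StrictTotal ξ) (hadm : Adm v ξ) {x y z : A}
    (hxy : ξ x y) (hyz : ξ y z) :
    mpiAux v ξ x z = max (mpiAux v ξ x y) (mpiAux v ξ y z) := by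
  apply le_antisymm
  · refine Real.sSup_le ?_ (le_max_of_le_left (mpiAux_nonneg hξ hadm x y))
    rintro s ⟨p, q, hxp, hpz, hpq, rfl⟩
    by_cases hpy : ξ p y
    · exact le_max_of_le_left (msigma_le_mpiAux hxp hpy hpq)
    · refine le_max_of_le_right (msigma_le_mpiAux ?_ hpz hpq)
      by_cases h : p = y
      · exact Or.inr h
      · exact Or.inl ((hξ.2.2 p y h).resolve_left hpy)
  · refine max_le ?_ ?_
    · refine Real.sSup_le ?_ (mpiAux_nonneg hξ hadm x z)
      rintro s ⟨p, q, hxp, hpy, hpq, rfl⟩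
      exact msigma_le_mpiAux hxp (hξ.2.1 _ _ _ hpy hyz) hpq
    · refine Real.sSup_le ?_ (mpiAux_nonneg hξ hadm x z)
      rintro s ⟨p, q, hyp, hpz, hpq, rfl⟩
      refine msigma_le_mpiAux (Or.inl ?_) hpz hpq
      rcases hyp with hyp | rfl
      · exact hξ.2.1 _ _ _ hxy hyp
      · exact hxy

/-- The projected margin of `x` over `y` is positive exactly when `x` and `y` are separated by
a set all of whose elements defeat all the elements outside it. -/
theorem mpiAux_pos_iff [Finite A] (hξ : StrictTotal ξ) (hadm : Adm v ξ) {x y : A} :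
    0 < mpiAux v ξ x y ↔
      ∃ I : Set A, x ∈ I ∧ y ∉ I ∧ ∀ p ∈ I, ∀ q ∉ I, istar v p q > istar v q p := by
  constructor
  · intro h
    obtain ⟨p, q, hxp, hpy, hpq, hpos⟩ : ∃ p q, (ξ x p ∨ p = x) ∧ ξ p y ∧ ImmSucc ξ p q ∧
        0 < msigma v ξ p q := by
      by_contra! hcon
      refine h.not_ge (Real.sSup_nonpos ?_)
      rintro s ⟨p, q, hxp, hpy, hpq, rfl⟩
      exact hcon p q hxp hpy hpq
    refine ⟨{z | ξ z p ∨ z = p}, hxp.imp_right Eq.symm, ?_, ?_⟩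
    · rintro (h' | rfl)
      · exact hξ.asymm hpy h'
      · exact hξ.1 _ hpy
    · intro p' hp' q' hq'
      simp only [Set.mem_ofPred_eq, not_or] at hq'
      refine msigma_pos_iff.1 hpos p' q' hp' ?_
      have hpq' : ξ p q' := (hξ.2.2 p q' (Ne.symm hq'.2)).resolve_right hq'.1
      by_cases h' : q' = q
      · exact Or.inr h'
      · exact Or.inl ((hξ.2.2 q' q h').resolve_left fun hh => hpq.2 q' ⟨hpq', hh⟩)
  · rintro ⟨I, hx, hy, hI⟩
    have : IsTrans A ξ := ⟨hξ.2.1⟩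
    have : Std.Irrefl ξ := ⟨hξ.1⟩
    obtain ⟨p, hp, hpmax⟩ :=
      (Finite.wellFounded_of_trans_of_irrefl (Function.swap ξ)).has_min I ⟨x, hx⟩
    obtain ⟨q, hq, hqmin⟩ := (Finite.wellFounded_of_trans_of_irrefl ξ).has_min Iᶜ ⟨y, hy⟩
    have hlt : ∀ a ∈ I, ∀ b ∉ I, ξ a b := fun a ha b hb => hadm a b (hI a ha b hb)
    have hpq : ImmSucc ξ p q := by
      refine ⟨hlt p hp q hq, fun z hz => ?_⟩
      by_cases hzI : z ∈ I
      · exact hpmax z hzI hz.1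
      · exact hqmin z hzI hz.2
    have hxp : ξ x p ∨ p = x := by
      by_cases h : p = x
      · exact Or.inr h
      · exact Or.inl ((hξ.2.2 p x h).resolve_left (hpmax x hx))
    refine lt_of_lt_of_le (msigma_pos_iff.2 fun p' q' hp' hq' => ?_)
      (msigma_le_mpiAux hxp (hlt p hp y hy) hpq)
    refine hI p' ?_ q' ?_
    · rcases hp' with hp' | rfl
      · by_contra h
        exact hξ.asymm hp' (hlt p hp p' h)
      · exact hp
    · rcases hq' with hq' | rfl
      · intro h
        exact hξ.asymm hq' (hlt q' h q hq)
      · exact hq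

end Projection

section Rates

variable {A : Type*} {v : A → A → ℝ} {ξ : A → A → Prop}

theorem mpi_le_mpi [Finite A] (hξ : StrictTotal ξ) (hadm : Adm v ξ) {x y k : A} (hxy : ξ x y)
    (hkx : k ≠ x) (hky : k ≠ y) : mpi v ξ y k ≤ mpi v ξ x k := by
  have hnn := mpiAux_nonneg hξ hadm
  rcases hξ.2.2 k x hkx with h | h
  · have h' := hξ.2.1 _ _ _ h hxy
    rw [mpi, mpi, if_neg (hξ.asymm h'), if_neg (hξ.asymm h), mpiAux_eq_max hξ hadm h hxy]
    exact neg_le_neg (le_max_left _ _)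
  · rcases hξ.2.2 k y hky with h' | h'
    · rw [mpi, mpi, if_neg (hξ.asymm h'), if_pos h]
      linarith [hnn k y, hnn x k]
    · rw [mpi, mpi, if_pos h', if_pos h, mpiAux_eq_max hξ hadm hxy h']
      exact le_max_right _ _

theorem mpi_eq_mpi_of_mpiAux_eq_zero [Finite A] (hξ : StrictTotal ξ) (hadm : Adm v ξ) {x y k : A}
    (hxy : ξ x y) (h0 : mpiAux v ξ x y = 0) (hkx : k ≠ x) (hky : k ≠ y) :
    mpi v ξ y k = mpi v ξ x k := by
  have hnn := mpiAux_nonneg hξ hadm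
  rcases hξ.2.2 k x hkx with h | h
  · have h' := hξ.2.1 _ _ _ h hxy
    rw [mpi, mpi, if_neg (hξ.asymm h'), if_neg (hξ.asymm h), mpiAux_eq_max hξ hadm h hxy, h0,
      max_eq_left (hnn k x)]
  · rcases hξ.2.2 k y hky with h' | h'
    · rw [mpiAux_eq_max hξ hadm h h'] at h0
      rw [mpi, mpi, if_neg (hξ.asymm h'), if_pos h]
      linarith [hnn k y, hnn x k, le_max_left (mpiAux v ξ x k) (mpiAux v ξ k y),
        le_max_right (mpiAux v ξ x k) (mpiAux v ξ k y)]
    · rw [mpi, mpi, if_pos h', if_pos h, mpiAux_eq_max hξ hadm hxy h', h0,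
        max_eq_right (hnn y k)]

variable [Fintype A] [DecidableEq A]

theorem rlr_sub_rlr (hξ : StrictTotal ξ) {x y : A} (hxy : ξ x y) :
    rlr v ξ y - rlr v ξ x = mpiAux v ξ x y +
      ∑ k ∈ (Finset.univ.erase x).erase y, (mpi v ξ x k - mpi v ξ y k) / 2 := by
  have hne : x ≠ y := fun h => hξ.1 y (h ▸ hxy)
  have hx : ∑ k ∈ Finset.univ.erase x, vpi v ξ x k =
      vpi v ξ x y + ∑ k ∈ (Finset.univ.erase x).erase y, vpi v ξ x k :=
    (Finset.add_sum_erase _ _ (by simpa using hne.symm)).symm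
  have hy : ∑ k ∈ Finset.univ.erase y, vpi v ξ y k =
      vpi v ξ y x + ∑ k ∈ (Finset.univ.erase x).erase y, vpi v ξ y k := by
    rw [Finset.erase_right_comm]
    exact (Finset.add_sum_erase _ _ (by simpa using hne)).symm
  have hsum : ∑ k ∈ (Finset.univ.erase x).erase y, (mpi v ξ x k - mpi v ξ y k) / 2 =
      ∑ k ∈ (Finset.univ.erase x).erase y, vpi v ξ x k -
        ∑ k ∈ (Finset.univ.erase x).erase y, vpi v ξ y k := by
    rw [← Finset.sum_sub_distrib]
    refine Finset.sum_congr rfl fun k _ => ?_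
    simp only [vpi]
    ring
  have h1 : mpi v ξ x y = mpiAux v ξ x y := if_pos hxy
  have h2 : mpi v ξ y x = -mpiAux v ξ x y := if_neg (hξ.asymm hxy)
  have h3 : vpi v ξ x y = (1 + mpiAux v ξ x y) / 2 := by rw [vpi, h1]
  have h4 : vpi v ξ y x = (1 - mpiAux v ξ x y) / 2 := by rw [vpi, h2, ← sub_eq_add_neg]
  rw [rlr, rlr, hx, hy, hsum, h3, h4]
  ring

theorem mpiAux_le_rlr_sub_rlr (hξ : StrictTotal ξ) (hadm : Adm v ξ) {x y : A} (hxy : ξ x y) :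
    mpiAux v ξ x y ≤ rlr v ξ y - rlr v ξ x := by
  rw [rlr_sub_rlr hξ hxy]
  refine le_add_of_nonneg_right (Finset.sum_nonneg fun k hk => ?_)
  simp only [Finset.mem_erase, Finset.mem_univ, and_true] at hk
  linarith [mpi_le_mpi hξ hadm hxy hk.2 hk.1]

theorem rlr_eq_rlr_of_mpiAux_eq_zero (hξ : StrictTotal ξ) (hadm : Adm v ξ) {x y : A}
    (hxy : ξ x y) (h0 : mpiAux v ξ x y = 0) : rlr v ξ x = rlr v ξ y := by
  have h := rlr_sub_rlr (v := v) hξ hxy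
  rw [h0, zero_add, Finset.sum_eq_zero] at h
  · linarith
  · intro k hk
    simp only [Finset.mem_erase, Finset.mem_univ, and_true] at hk
    rw [mpi_eq_mpi_of_mpiAux_eq_zero hξ hadm hxy h0 hk.2 hk.1, sub_self, zero_div]

/-- The strict order of the rank-like rates is determined by the sets all of whose elements
defeat all the elements outside; in particular it does not depend on the admissible order. -/
theorem rlr_lt_rlr_iff (hξ : StrictTotal ξ) (hadm : Adm v ξ) {x y : A} :
    rlr v ξ x < rlr v ξ y ↔
      ∃ I : Set A, x ∈ I ∧ y ∉ I ∧ ∀ p ∈ I, ∀ q ∉ I, istar v p q > istar v q p := by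
  rw [← mpiAux_pos_iff hξ hadm]
  constructor
  · intro h
    have hne : x ≠ y := fun hxy => (hxy ▸ h).false
    have hxy : ξ x y := by
      refine (hξ.2.2 x y hne).resolve_right fun hyx => ?_
      linarith [mpiAux_le_rlr_sub_rlr hξ hadm hyx, mpiAux_nonneg hξ hadm y x]
    refine (mpiAux_nonneg hξ hadm x y).lt_of_ne fun h0 => ?_
    exact h.ne (rlr_eq_rlr_of_mpiAux_eq_zero hξ hadm hxy h0.symm)
  · intro h
    obtain ⟨I, hx, hy, hI⟩ := (mpiAux_pos_iff hξ hadm).1 h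
    linarith [mpiAux_le_rlr_sub_rlr hξ hadm (hadm x y (hI x hx y hy))]

end Rates

/-- Clone consistency: If `C ⊊ A` is autonomous for a complete
Llull matrix `v`, then `C` is autonomous for the indirect comparison relation
`ν` and for the total preorder `{(x,y) : x ≠ y, R_x ≤ R_y}` determined by the
rank-like rates. -/
theorem stmt18 {A : Type*} [Fintype A] [DecidableEq A] (v : A → A → ℝ)
    (hv : Llull v) (C : Set A) (hC : C ≠ Set.univ)
    (haut : ∀ a ∈ C, ∀ b ∈ C, ∀ x ∉ C, v a x = v b x ∧ v x a = v x b)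
    (ξ : A → A → Prop) (hξ : StrictTotal ξ) (hadm : Adm v ξ) :
    AutonomousRel C (fun x y => x ≠ y ∧ istar v x y > istar v y x) ∧
    AutonomousRel C (fun x y => x ≠ y ∧ rlr v ξ x ≤ rlr v ξ y) := by
  have hC' : ∀ {a b x}, a ∈ C → b ∈ C → x ∉ C →
      istar v a x = istar v b x ∧ istar v x a = istar v x b :=
    fun ha hb hx => istar_autonomous hv haut ha hb hx
  have hne : ∀ {c x}, c ∈ C → x ∉ C → c ≠ x := fun hc hx h => hx (h ▸ hc)
  refine ⟨fun x hx => ⟨?_, ?_⟩, fun x hx => ⟨?_, ?_⟩⟩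
  · rintro ⟨a, ha, -, h⟩ b hb
    refine ⟨hne hb hx, ?_⟩
    rwa [(hC' hb ha hx).1, (hC' hb ha hx).2]
  · rintro ⟨a, ha, -, h⟩ b hb
    refine ⟨(hne hb hx).symm, ?_⟩
    rwa [(hC' hb ha hx).1, (hC' hb ha hx).2]
  · rintro ⟨a, ha, -, h⟩ b hb
    refine ⟨hne hb hx, ?_⟩
    contrapose! h
    obtain ⟨I, hxI, hbI, hI⟩ := (rlr_lt_rlr_iff hξ hadm).1 h
    refine (rlr_lt_rlr_iff hξ hadm).2 ⟨I \ C, ⟨hxI, hx⟩, fun h => h.2 ha, ?_⟩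
    rintro p ⟨hp, hpC⟩ q hq
    by_cases hqI : q ∈ I
    · have hqC : q ∈ C := by
        by_contra hqC
        exact hq ⟨hqI, hqC⟩
      rw [(hC' hqC hb hpC).1, (hC' hqC hb hpC).2]
      exact hI p hp b hbI
    · exact hI p hp q hqI
  · rintro ⟨a, ha, -, h⟩ b hb
    refine ⟨(hne hb hx).symm, ?_⟩
    contrapose! h
    obtain ⟨I, hbI, hxI, hI⟩ := (rlr_lt_rlr_iff hξ hadm).1 h
    refine (rlr_lt_rlr_iff hξ hadm).2 ⟨I ∪ C, Or.inr ha, fun h => h.elim hxI hx, ?_⟩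
    intro p hp q hq
    rw [Set.mem_union, not_or] at hq
    rcases hp with hp | hp
    · exact hI p hp q hq.1
    · rw [(hC' hp hb hq.2).1, (hC' hp hb hq.2).2]
      exact hI b hbI q hq.1
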